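/- Let (V,H) be a p+q almost-product structure on an n-dimensional (pseudo-)Riemannian manifold (M,g), with projectors v and h = g − v. The following statements are equivalent: (i) (V,H) is a totally geodesic almost-product structure (both planes geodesic, S_v = 0 = S_h); (ii) C v + D h is a Killing tensor for arbitrary constants C and D; (iii) C(q v − p h) is a conformal tensor for an arbitrary constant C. -/

import Mathlib

/- An algebraic model of the differential geometry of an n-dimensional
(pseudo-)Riemannian manifold: `F` models the ring of smooth real functions,
`X` the `F`-module of vector fields, `act` the action of vector fields on
functions by derivation, `bracket` the Lie bracket, `g` the metric, `conn`
the Levi-Civita connection and `e`, `eps` a (pseudo-)orthonormal frame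
recording the dimension and the signature. -/

noncomputable section

namespace KCT

/-- complex multiplication on pairs of functions -/
def cxMul {F : Type} [CommRing F] (a b : F × F) : F × F :=
  (a.1 * b.1 - a.2 * b.2, a.1 * b.2 + a.2 * b.1)

/-- the imaginary unit -/
def cxI {F : Type} [CommRing F] : F × F := (0, 1)

/-- complex conjugation -/
def cxConj {F : Type} [CommRing F] (a : F × F) : F × F := (a.1, -a.2)

def cxSmul {F : Type} [CommRing F] (f : F) (a : F × F) : F × F := (f * a.1, f * a.2)

/-- complex inverse (meaningful when the squared modulus is invertible) -/
def cxInv {F : Type} [CommRing F] (a : F × F) : F × F :=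
  cxSmul (Ring.inverse (a.1 * a.1 + a.2 * a.2)) (cxConj a)

/-- The underlying (local) smooth manifold: smooth functions `F`,
vector fields `X`, derivations and Lie bracket. -/
structure Man where
  F : Type
  [instCRF : CommRing F]
  [instAlg : Algebra ℝ F]
  X : Type
  [instACG : AddCommGroup X]
  [instMod : Module F X]
  act : X → F → F
  bracket : X → X → X
  act_addf : ∀ x f₁ f₂, act x (f₁ + f₂) = act x f₁ + act x f₂
  act_mulf : ∀ x f₁ f₂, act x (f₁ * f₂) = act x f₁ * f₂ + f₁ * act x f₂
  act_addv : ∀ x y f, act (x + y) f = act x f + act y f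
  act_smulv : ∀ (h : F) x f, act (h • x) f = h * act x f
  act_const : ∀ x r, act x (algebraMap ℝ F r) = 0
  /-- pointwise positivity of a function -/
  Pos : F → Prop
  pos_one : Pos 1
  pos_mul : ∀ f h, Pos f → Pos h → Pos (f * h)
  pos_unit : ∀ f, Pos f → IsUnit f
  sq_pos : ∀ f, IsUnit f → Pos (f * f)
  /-- the exponential of a function -/
  fexp : F → F
  fexp_unit : ∀ f, IsUnit (fexp f)
  fexp_deriv : ∀ x f, act x (fexp f) = fexp f * act x f
  /-- locally, closed one-forms are exact -/
  closed_exact : ∀ ω : X → F, (∀ (f : F) x, ω (f • x) = f * ω x) →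
    (∀ x y, ω (x + y) = ω x + ω y) →
    (∀ x y, act x (ω y) - act y (ω x) - ω (bracket x y) = 0) →
    ∃ f : F, ∀ x, ω x = act x f

attribute [instance] Man.instCRF Man.instAlg Man.instACG Man.instMod

/-- extension of the derivation action to complex valued functions -/
def Man.cxAct (M : Man) (x : M.X) (f : M.F × M.F) : M.F × M.F := (M.act x f.1, M.act x f.2)

/-- An `n`-dimensional (pseudo-)Riemannian metric on `M` together with its
Levi-Civita connection and a (pseudo-)orthonormal frame. -/
structure Metric (M : Man) (n : ℕ) where
  g : M.X → M.X → M.F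
  conn : M.X → M.X → M.X
  e : Fin n → M.X
  eps : Fin n → M.F
  g_symm : ∀ x y, g x y = g y x
  g_addl : ∀ x y z, g (x + y) z = g x z + g y z
  g_smull : ∀ (f : M.F) x y, g (f • x) y = f * g x y
  conn_addl : ∀ x y z, conn (x + y) z = conn x z + conn y z
  conn_smull : ∀ (f : M.F) x y, conn (f • x) y = f • conn x y
  conn_addr : ∀ x y z, conn x (y + z) = conn x y + conn x z
  conn_leibniz : ∀ x (f : M.F) y, conn x (f • y) = M.act x f • y + f • conn x y
  torsion_free : ∀ x y, conn x y - conn y x = M.bracket x y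
  metric_compat : ∀ x y z, M.act x (g y z) = g (conn x y) z + g y (conn x z)
  frame_on : ∀ i j, g (e i) (e j) = if i = j then eps i else 0
  eps_pm : ∀ i, eps i = 1 ∨ eps i = -1
  frame_complete : ∀ x, x = ∑ i, (eps i * g x (e i)) • e i

namespace Metric

variable {M : Man} {n : ℕ} (G : Metric M n)

/-- `{x,y} = ∇ₓ y + ∇_y x` -/
def sb (x y : M.X) : M.X := G.conn x y + G.conn y x

/-- covariant derivative of a 2-tensor -/
def nabla2 (T : M.X → M.X → M.F) (x y z : M.X) : M.F :=
  M.act x (T y z) - T (G.conn x y) z - T y (G.conn x z)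

/-- total symmetrization `∇_(a T_bc)` (cyclic sum) -/
def killingOp (T : M.X → M.X → M.F) (x y z : M.X) : M.F :=
  G.nabla2 T x y z + G.nabla2 T y z x + G.nabla2 T z x y

def Bilin (_G : Metric M n) (T : M.X → M.X → M.F) : Prop :=
  (∀ (f : M.F) x y, T (f • x) y = f * T x y) ∧ (∀ x y z, T (x + y) z = T x z + T y z) ∧
    (∀ (f : M.F) x y, T x (f • y) = f * T x y) ∧ (∀ x y z, T x (y + z) = T x y + T x z)

def Symm2 (_G : Metric M n) (T : M.X → M.X → M.F) : Prop := ∀ x y, T x y = T y x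

/-- second order Killing tensor: `∇_(a K_bc) = 0` -/
def IsKilling (T : M.X → M.X → M.F) : Prop :=
  G.Bilin T ∧ G.Symm2 T ∧ ∀ x y z, G.killingOp T x y z = 0

/-- the total symmetrization `S{g ⊗ t}` -/
def symG (t : M.X → M.F) (x y z : M.X) : M.F :=
  G.g x y * t z + G.g y z * t x + G.g z x * t y

/-- metric trace of a 2-tensor -/
def tr2 (T : M.X → M.X → M.F) : M.F := ∑ i, G.eps i * T (G.e i) (G.e i)

/-- divergence `(∇·T)_c = ∇^a T_ac` -/
def div2 (T : M.X → M.X → M.F) (z : M.X) : M.F :=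
  ∑ i, G.eps i * G.nabla2 T (G.e i) (G.e i) z

/-- the canonical 1-form `t = (2/(n+2)) ∇·T` of the conformal equation -/
def ct (T : M.X → M.X → M.F) (z : M.X) : M.F :=
  algebraMap ℝ M.F (2 / ((n : ℝ) + 2)) * G.div2 T z

/-- conformal equation with a prescribed 1-form `t` -/
def IsConformalWith (T : M.X → M.X → M.F) (t : M.X → M.F) : Prop :=
  G.Bilin T ∧ G.Symm2 T ∧ ∀ x y z, G.killingOp T x y z = G.symG t x y z

/-- second order conformal tensor: `∇_(a T_bc) = S{g ⊗ t}`, `t = (2/(n+2)) ∇·T` -/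
def IsConformal (T : M.X → M.X → M.F) : Prop := G.IsConformalWith T (G.ct T)

/-- the 1-form associated to a vector field -/
def flat (x z : M.X) : M.F := G.g x z

/-- exterior derivative of a 1-form -/
def d1 (_G : Metric M n) (ω : M.X → M.F) (x y : M.X) : M.F :=
  M.act x (ω y) - M.act y (ω x) - ω (M.bracket x y)

def Closed1 (ω : M.X → M.F) : Prop := ∀ x y, G.d1 ω x y = 0

/-- gradient vector field of a function -/
def grad (f : M.F) : M.X := ∑ i, (G.eps i * M.act (G.e i) f) • G.e i

/-- vector field associated to a 1-form -/
def sharp (ω : M.X → M.F) : M.X := ∑ i, (G.eps i * ω (G.e i)) • G.e i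

/-- `x` is an eigenvector field of `T` with eigenvalue function `ρ` -/
def IsEigen (T : M.X → M.X → M.F) (ρ : M.F) (x : M.X) : Prop := ∀ z, T x z = ρ * G.g x z

/-- orthogonal projector onto a (regular) distribution -/
def IsProjector (v : M.X → M.X) : Prop :=
  (∀ (f : M.F) x, v (f • x) = f • v x) ∧ (∀ x y, v (x + y) = v x + v y) ∧
    (∀ x, v (v x) = v x) ∧ (∀ x y, G.g (v x) y = G.g x (v y))

/-- trace of a projector (= dimension of the distribution) -/
def ptrace (v : M.X → M.X) : M.F := ∑ i, G.eps i * G.g (v (G.e i)) (G.e i)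

/-- the complementary (orthogonal) projector -/
def co (_G : Metric M n) (v : M.X → M.X) (x : M.X) : M.X := x - v x

/-- generalized second fundamental form `Q_v(x,y) = h(∇_{v(x)} v(y))` -/
def Qv (v : M.X → M.X) (x y : M.X) : M.X := G.co v (G.conn (v x) (v y))

/-- umbilical distribution with `S_v = ½ v ⊗ a` -/
def UmbilicalWith (v : M.X → M.X) (a : M.X) : Prop :=
  ∀ x y, G.Qv v x y + G.Qv v y x = G.g (v x) (v y) • a

/-- umbilical distribution of dimension `p` : `S_v = (1/p) v ⊗ Tr S_v` -/
def Umbilical (v : M.X → M.X) (p : ℕ) : Prop :=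
  ∀ x y, (p : M.F) • (G.Qv v x y + G.Qv v y x)
    = (2 * G.g (v x) (v y)) • ∑ i, G.eps i • G.Qv v (G.e i) (G.e i)

/-- (totally) geodesic distribution: `S_v = 0` -/
def Geodesic (v : M.X → M.X) : Prop := ∀ x y, G.Qv v x y + G.Qv v y x = 0

/-- the symmetric 2-tensor `α v + β h` of an almost-product structure -/
def apTensor (v : M.X → M.X) (α β : M.F) (x y : M.X) : M.F :=
  α * G.g (v x) y + β * G.g (x - v x) y

/-- projector on the line spanned by the unitary (`g(u,u) = ε = ±1`) field `u` -/
def uproj (u : M.X) (ε : M.F) (x : M.X) : M.X := (ε * G.g u x) • u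

/-- acceleration `u̇ = ∇_u u` -/
def acc (u : M.X) : M.X := G.conn u u

/-- expansion `θ = ∇·u` -/
def expan (u : M.X) : M.F := ∑ i, G.eps i * G.g (G.conn (G.e i) u) (G.e i)

/-- vanishing of the shear `σ` of a unitary vector field `u` -/
def ShearFree (u : M.X) (ε : M.F) : Prop := ∀ x y,
  G.g (G.conn (G.co (G.uproj u ε) x) u) (G.co (G.uproj u ε) y)
      + G.g (G.conn (G.co (G.uproj u ε) y) u) (G.co (G.uproj u ε) x)
    = algebraMap ℝ M.F (2 / ((n : ℝ) - 1)) * G.expan u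
        * G.g (G.co (G.uproj u ε) x) (G.co (G.uproj u ε) y)

/-- condition (i) of Proposition 1: on each eigenspace,
`(T - ρ g){x,y} = g(x,y)(dρ - t)` -/
def CondI (T : M.X → M.X → M.F) (t : M.X → M.F) : Prop :=
  ∀ (ρ : M.F) (x y : M.X), G.IsEigen T ρ x → G.IsEigen T ρ y → ∀ z,
    T (G.sb x y) z - ρ * G.g (G.sb x y) z = G.g x y * (M.act z ρ - t z)

/-- condition (ii) of Proposition 1 (condition (iii) of Theorem 1):
for eigenvectors with pairwise different eigenvalues,
`T(x,{y,z}) + T(z,{x,y}) + T(y,{z,x}) = 0` -/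
def CondIII (T : M.X → M.X → M.F) : Prop :=
  ∀ (ρ₁ ρ₂ ρ₃ : M.F) (x y z : M.X),
    G.IsEigen T ρ₁ x → G.IsEigen T ρ₂ y → G.IsEigen T ρ₃ z →
    IsUnit (ρ₁ - ρ₂) → IsUnit (ρ₂ - ρ₃) → IsUnit (ρ₁ - ρ₃) →
    T x (G.sb y z) + T z (G.sb x y) + T y (G.sb z x) = 0

/- Curvature -/

def curv (x y z : M.X) : M.X :=
  G.conn x (G.conn y z) - G.conn y (G.conn x z) - G.conn (M.bracket x y) z

def riem (x y z w : M.X) : M.F := G.g (G.curv x y z) w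

def ricci (x y : M.X) : M.F := ∑ i, G.eps i * G.riem (G.e i) x y (G.e i)

def scal : M.F := ∑ i, G.eps i * G.ricci (G.e i) (G.e i)

/-- covariant derivative of a 4-tensor -/
def nabla4 (T : M.X → M.X → M.X → M.X → M.F) (x a b c d : M.X) : M.F :=
  M.act x (T a b c d) - T (G.conn x a) b c d - T a (G.conn x b) c d
    - T a b (G.conn x c) d - T a b c (G.conn x d)

/- Dimension four: Hodge duality, self-dual formalism, Weyl tensor -/

/-- composition (`Tr₂₃`-contraction) of two 2-tensors -/
def comp2 (A B : M.X → M.X → M.F) (x y : M.X) : M.F :=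
  ∑ i, G.eps i * A x (G.e i) * B (G.e i) y

end Metric

namespace Metric

variable {M : Man} (G : Metric M 4)

/-- the metric volume element `η` -/
def vol (x0 x1 x2 x3 : M.X) : M.F :=
  ((Matrix.of fun i j => G.eps j * G.g (![x0, x1, x2, x3] i) (G.e j)) :
    Matrix (Fin 4) (Fin 4) M.F).det

/-- Hodge dual of a 2-form -/
def hodge (U : M.X → M.X → M.F) (x y : M.X) : M.F :=
  algebraMap ℝ M.F (1 / 2) *
    ∑ i, ∑ j, G.eps i * G.eps j * G.vol x y (G.e i) (G.e j) * U (G.e i) (G.e j)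

/-- exterior codifferential of a 2-form -/
def codiff2 (U : M.X → M.X → M.F) (z : M.X) : M.F :=
  -∑ i, G.eps i * G.nabla2 U (G.e i) (G.e i) z

/-- the 1-form `i(δU)U` -/
def iD (U : M.X → M.X → M.F) (z : M.X) : M.F := U (G.sharp (G.codiff2 U)) z

/-- `Φ[U] = i(δU)U - i(δ*U)*U` -/
def Phi (U : M.X → M.X → M.F) (z : M.X) : M.F := G.iD U z - G.iD (G.hodge U) z

/-- the self-dual unitary 2-form `𝒰 = (1/√2)(U - i *U)` -/
def sdU (U : M.X → M.X → M.F) (x y : M.X) : M.F × M.F :=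
  (algebraMap ℝ M.F (Real.sqrt 2)⁻¹ * U x y,
    -(algebraMap ℝ M.F (Real.sqrt 2)⁻¹ * G.hodge U x y))

/-- the self-dual metric `𝒢 = ½(G - i η)` -/
def sdG (a b c d : M.X) : M.F × M.F :=
  (algebraMap ℝ M.F (1 / 2) * (G.g a c * G.g b d - G.g a d * G.g b c),
    -(algebraMap ℝ M.F (1 / 2) * G.vol a b c d))

/-- covariant derivative of a complex 2-tensor -/
def nabla2C (T : M.X → M.X → M.F × M.F) (x y z : M.X) : M.F × M.F :=
  M.cxAct x (T y z) - T (G.conn x y) z - T y (G.conn x z)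

/-- codifferential of a complex 2-form -/
def codiff2C (T : M.X → M.X → M.F × M.F) (z : M.X) : M.F × M.F :=
  -∑ i, cxSmul (G.eps i) (G.nabla2C T (G.e i) (G.e i) z)

/-- the (complex) vector field associated with a complex 1-form -/
def sharpC (ω : M.X → M.F × M.F) : M.X × M.X :=
  (G.sharp fun z => (ω z).1, G.sharp fun z => (ω z).2)

/-- evaluation of a complex 2-form on a complex vector (first slot) -/
def evalC (_G : Metric M 4) (T : M.X → M.X → M.F × M.F) (ξ : M.X × M.X) (z : M.X) : M.F × M.F :=
  T ξ.1 z + cxMul cxI (T ξ.2 z)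

/-- interior product of a complex vector with a complex 4-tensor (first slot) -/
def evalC4 (_G : Metric M 4) (A : M.X → M.X → M.X → M.X → M.F × M.F) (ξ : M.X × M.X) (x y z : M.X) :
    M.F × M.F :=
  A ξ.1 x y z + cxMul cxI (A ξ.2 x y z)

/-- `Σ[U] ≡ ∇𝒰 - i(δ𝒰)𝒰 ⊗ 𝒰 - i(δ𝒰)𝒢 = 0` (the umbilical condition) -/
def SigmaCond (U : M.X → M.X → M.F) : Prop :=
  ∀ x y z, G.nabla2C (G.sdU U) x y z
    = cxMul (G.evalC (G.sdU U) (G.sharpC (G.codiff2C (G.sdU U))) x) (G.sdU U y z)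
        + G.evalC4 G.sdG (G.sharpC (G.codiff2C (G.sdU U))) x y z

/-- the Weyl tensor (dimension four) -/
def weyl (a b c d : M.X) : M.F :=
  G.riem a b c d
    - algebraMap ℝ M.F (1 / 2) * (G.g a c * G.ricci b d + G.g b d * G.ricci a c
        - G.g a d * G.ricci b c - G.g b c * G.ricci a d)
    + algebraMap ℝ M.F (1 / 6) * G.scal * (G.g a c * G.g b d - G.g a d * G.g b c)

/-- Hodge dual of a double 2-form on its first pair of indices -/
def hodgeL (T : M.X → M.X → M.X → M.X → M.F) (a b c d : M.X) : M.F :=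
  algebraMap ℝ M.F (1 / 2) *
    ∑ i, ∑ j, G.eps i * G.eps j * G.vol a b (G.e i) (G.e j) * T (G.e i) (G.e j) c d

/-- the self-dual Weyl tensor `𝒲 = ½(W - i *W)` -/
def cWeyl (a b c d : M.X) : M.F × M.F :=
  (algebraMap ℝ M.F (1 / 2) * G.weyl a b c d,
    -(algebraMap ℝ M.F (1 / 2) * G.hodgeL G.weyl a b c d))

/-- composition of complex double 2-forms (as endomorphisms of bivectors) -/
def compW (A B : M.X → M.X → M.X → M.X → M.F × M.F) (a b c d : M.X) : M.F × M.F :=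
  cxSmul (algebraMap ℝ M.F (1 / 2))
    (∑ i, ∑ j, cxSmul (G.eps i * G.eps j)
      (cxMul (A a b (G.e i) (G.e j)) (B (G.e i) (G.e j) c d)))

/-- trace of a complex double 2-form (as an endomorphism of bivectors) -/
def trW (A : M.X → M.X → M.X → M.X → M.F × M.F) : M.F × M.F :=
  cxSmul (algebraMap ℝ M.F (1 / 2))
    (∑ i, ∑ j, cxSmul (G.eps i * G.eps j) (A (G.e i) (G.e j) (G.e i) (G.e j)))

/-- the double Weyl eigenvalue `ρ = -Tr 𝒲³ / Tr 𝒲²` -/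
def rhoWeyl : M.F × M.F :=
  -(cxMul (cxInv (G.trW (G.compW G.cWeyl G.cWeyl)))
      (G.trW (G.compW (G.compW G.cWeyl G.cWeyl) G.cWeyl)))

/-- the concomitant `𝒮 = (1/(3ρ))(𝒲 - ρ 𝒢)` -/
def sWeyl (a b c d : M.X) : M.F × M.F :=
  cxMul (cxInv (cxSmul 3 G.rhoWeyl)) (G.cWeyl a b c d - cxMul G.rhoWeyl (G.sdG a b c d))

/-- divergence-free Weyl tensor (vanishing Cotton tensor): `δW = 0` -/
def DivFreeWeyl : Prop :=
  ∀ b c d, ∑ i, G.eps i * G.nabla4 G.weyl (G.e i) (G.e i) b c d = 0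

/-- the bivector image `A(X)` of a bivector by a double 2-form -/
def sContract (A : M.X → M.X → M.X → M.X → M.F × M.F) (Xb : M.X → M.X → M.F × M.F)
    (x y : M.X) : M.F × M.F :=
  cxSmul (algebraMap ℝ M.F (1 / 2))
    (∑ i, ∑ j, cxSmul (G.eps i * G.eps j)
      (cxMul (A x y (G.e i) (G.e j)) (Xb (G.e i) (G.e j))))

/-- the scalar `A(X,X)` -/
def sNorm (A : M.X → M.X → M.X → M.X → M.F × M.F) (Xb : M.X → M.X → M.F × M.F) :
    M.F × M.F :=
  cxSmul (algebraMap ℝ M.F (1 / 2))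
    (∑ i, ∑ j, cxSmul (G.eps i * G.eps j)
      (cxMul (G.sContract A Xb (G.e i) (G.e j)) (Xb (G.e i) (G.e j))))

/-- self-dual complex bivector: `*𝒳 = i 𝒳` -/
def SelfDualC (Xb : M.X → M.X → M.F × M.F) : Prop :=
  ∀ x y, ((G.hodge fun a b => (Xb a b).1) x y, (G.hodge fun a b => (Xb a b).2) x y)
    = cxMul cxI (Xb x y)

/-- Lorentzian signature (-+++) -/
def Lorentz : Prop := G.eps 0 = -1 ∧ G.eps 1 = 1 ∧ G.eps 2 = 1 ∧ G.eps 3 = 1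

end Metric


namespace Metric

variable {M : Man} {n : ℕ} (G : Metric M n)

lemma g_addr (x y z : M.X) : G.g x (y + z) = G.g x y + G.g x z := by
  rw [G.g_symm, G.g_addl, G.g_symm y, G.g_symm z]

lemma g_smulr (f : M.F) (x y : M.X) : G.g x (f • y) = f * G.g x y := by
  rw [G.g_symm, G.g_smull, G.g_symm y]

/-- the metric as a bilinear map -/
def gLin : M.X →ₗ[M.F] M.X →ₗ[M.F] M.F :=
  LinearMap.mk₂ M.F G.g G.g_addl G.g_smull (fun x y z => G.g_addr x y z)
    (fun f x y => G.g_smulr f x y)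

lemma gLin_apply (x y : M.X) : G.gLin x y = G.g x y := rfl

lemma g_subl (x y z : M.X) : G.g (x - y) z = G.g x z - G.g y z := by
  simp [← gLin_apply]

lemma g_subr (x y z : M.X) : G.g x (y - z) = G.g x y - G.g x z := by
  simp [← gLin_apply]

lemma g_zerol (y : M.X) : G.g 0 y = 0 := by
  simp [← gLin_apply]

lemma g_zeror (y : M.X) : G.g y 0 = 0 := by
  simp [← gLin_apply]

lemma eq_zero_of_g_eq_zero (x : M.X) (h : ∀ z, G.g x z = 0) : x = 0 := by
  rw [G.frame_complete x]
  simp [h]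

lemma conn_zerol (y : M.X) : G.conn 0 y = 0 := by
  simpa using G.conn_smull 0 0 y

lemma conn_zeror (x : M.X) : G.conn x 0 = 0 := by
  simpa using G.conn_addr x 0 0

lemma act_sub (x : M.X) (f h : M.F) : M.act x (f - h) = M.act x f - M.act x h := by
  rw [eq_sub_iff_add_eq, ← M.act_addf, sub_add_cancel]

lemma act_const_mul (x : M.X) (c : ℝ) (f : M.F) :
    M.act x (algebraMap ℝ M.F c * f) = algebraMap ℝ M.F c * M.act x f := by
  rw [M.act_mulf, M.act_const, zero_mul, zero_add]

lemma isUnit_algebraMap {c : ℝ} (hc : c ≠ 0) : IsUnit (algebraMap ℝ M.F c) :=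
  (isUnit_iff_ne_zero.mpr hc).map _

/-- contraction of a 1-form with a vector through the frame -/
lemma sum_frame (t : M.X →ₗ[M.F] M.F) (w : M.X) :
    ∑ i, G.eps i * (G.g w (G.e i) * t (G.e i)) = t w := by
  conv_rhs => rw [G.frame_complete w]
  simp [mul_assoc]

section Projector

variable {G} {v : M.X → M.X}

lemma IsProjector.map_zero (hv : G.IsProjector v) : v 0 = 0 := by
  simpa using hv.1 0 0

lemma IsProjector.map_sub (hv : G.IsProjector v) (x y : M.X) : v (x - y) = v x - v y := by
  rw [eq_sub_iff_add_eq, ← hv.2.1, sub_add_cancel]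

lemma IsProjector.co (hv : G.IsProjector v) : G.IsProjector (G.co v) := by
  refine ⟨fun f x => ?_, fun x y => ?_, fun x => ?_, fun x y => ?_⟩
  · simp only [Metric.co, hv.1, smul_sub]
  · simp only [Metric.co, hv.2.1]; abel
  · simp only [Metric.co, hv.map_sub, hv.2.2.1]; abel
  · simp only [Metric.co, G.g_subl, G.g_subr, hv.2.2.2]

lemma co_co (v : M.X → M.X) : G.co (G.co v) = v := by
  funext x; simp [Metric.co]

lemma IsProjector.co_apply (hv : G.IsProjector v) (x : M.X) : G.co v (v x) = 0 := by
  simp [Metric.co, hv.2.2.1]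

lemma IsProjector.apply_co (hv : G.IsProjector v) (x : M.X) : v (G.co v x) = 0 := by
  simp [Metric.co, hv.map_sub, hv.2.2.1]

/-- a self-adjoint map may be moved from one slot of a traced bilinear form to the other -/
lemma IsProjector.trace_comm (hv : G.IsProjector v) (B : M.X →ₗ[M.F] M.X →ₗ[M.F] M.F) :
    ∑ i, G.eps i * B (v (G.e i)) (G.e i) = ∑ i, G.eps i * B (G.e i) (v (G.e i)) := by
  have h1 : ∀ i, B (v (G.e i)) (G.e i)
      = ∑ j, G.eps j * (G.g (v (G.e i)) (G.e j) * B (G.e j) (G.e i)) := fun i =>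
    (G.sum_frame (B.flip (G.e i)) (v (G.e i))).symm
  have h2 : ∀ j, B (G.e j) (v (G.e j))
      = ∑ i, G.eps i * (G.g (v (G.e j)) (G.e i) * B (G.e j) (G.e i)) := fun j =>
    (G.sum_frame (B (G.e j)) (v (G.e j))).symm
  simp only [h1, h2, Finset.mul_sum]
  rw [Finset.sum_comm]
  refine Finset.sum_congr rfl fun j _ => Finset.sum_congr rfl fun i _ => ?_
  rw [hv.2.2.2 (G.e i), G.g_symm (G.e i)]
  ring

lemma IsProjector.trace_co_eq_zero (hv : G.IsProjector v)
    (B : M.X →ₗ[M.F] M.X →ₗ[M.F] M.F) :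
    ∑ i, G.eps i * B (v (G.e i)) (G.co v (G.e i)) = 0 := by
  let c : M.X →ₗ[M.F] M.X :=
    { toFun := G.co v, map_add' := hv.co.2.1, map_smul' := hv.co.1 }
  have h := hv.trace_comm (B.compl₂ c)
  simp only [LinearMap.compl₂_apply] at h
  refine h.trans (Finset.sum_eq_zero fun i _ => ?_)
  change G.eps i * B (G.e i) (G.co v (v (G.e i))) = 0
  rw [hv.co_apply]
  simp

lemma ptrace_co (v : M.X → M.X) : G.ptrace (G.co v) = (n : M.F) - G.ptrace v := by
  have h : ∀ i, G.eps i * G.eps i = 1 := fun i => by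
    rcases G.eps_pm i with h | h <;> simp [h]
  simp [ptrace, Metric.co, G.g_subl, mul_sub, G.frame_on, h]

/-- covariant derivative of a projector -/
lemma nabla2_projector (x y z : M.X) :
    G.nabla2 (fun a b => G.g (v a) b) x y z
      = G.g (G.conn x (v y) - v (G.conn x y)) z := by
  simp only [nabla2, G.metric_compat, G.g_subl]
  ring

lemma IsProjector.g_conn_skew (hv : G.IsProjector v) (x y z : M.X) :
    G.g (G.conn x (v y)) (G.co v z) = - G.g (v y) (G.conn x (G.co v z)) := by
  have h : G.g (v y) (G.co v z) = 0 := by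
    rw [hv.2.2.2, hv.apply_co, G.g_zeror]
  have h2 := G.metric_compat x (v y) (G.co v z)
  have h3 : M.act x 0 = 0 := by simpa using M.act_addf x 0 0
  rw [h, h3] at h2
  linear_combination -h2

/-- covariant derivative of a projector in terms of the second fundamental forms -/
lemma IsProjector.nabla2_eq_Qv (hv : G.IsProjector v) (x y z : M.X) :
    G.nabla2 (fun a b => G.g (v a) b) x y z
      = G.g (G.Qv v x y) z + G.g (G.Qv v x z) y
        - G.g (G.Qv (G.co v) x y) z - G.g (G.Qv (G.co v) x z) y := by
  have e1 : G.g (G.Qv v x z) y = - G.g (v (G.conn (v x) (G.co v y))) z := by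
    rw [Qv, hv.co.2.2.2, hv.g_conn_skew, G.g_symm, hv.2.2.2]
  have e2 : G.g (G.Qv (G.co v) x z) y = - G.g (G.co v (G.conn (G.co v x) (v y))) z := by
    have h := hv.co.g_conn_skew (G.co v x) z y
    rw [co_co] at h
    rw [Qv, co_co, hv.2.2.2, h, G.g_symm, hv.co.2.2.2]
  have e3 : v (G.conn x y) = v (G.conn x (v y)) + v (G.conn x (G.co v y)) := by
    rw [← hv.2.1, ← G.conn_addr]; simp [Metric.co]
  have e4 : ∀ w, G.conn x w = G.conn (v x) w + G.conn (G.co v x) w := fun w => by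
    rw [← G.conn_addl]; simp [Metric.co]
  rw [nabla2_projector, e1, e2, e3, Qv, Qv, co_co, e4 (v y), e4 (G.co v y)]
  simp only [Metric.co, hv.2.1, G.g_subl, G.g_addl]
  ring

lemma IsProjector.killingOp_eq (hv : G.IsProjector v) (x y z : M.X) :
    G.killingOp (fun a b => G.g (v a) b) x y z
      = G.g (G.Qv v x y + G.Qv v y x) z + G.g (G.Qv v y z + G.Qv v z y) x
        + G.g (G.Qv v z x + G.Qv v x z) y
        - G.g (G.Qv (G.co v) x y + G.Qv (G.co v) y x) z
        - G.g (G.Qv (G.co v) y z + G.Qv (G.co v) z y) x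
        - G.g (G.Qv (G.co v) z x + G.Qv (G.co v) x z) y := by
  simp only [killingOp, hv.nabla2_eq_Qv, G.g_addl]
  ring

lemma IsProjector.killingOp_eq_zero (hv : G.IsProjector v) (h1 : G.Geodesic v)
    (h2 : G.Geodesic (G.co v)) (x y z : M.X) :
    G.killingOp (fun a b => G.g (v a) b) x y z = 0 := by
  simp [hv.killingOp_eq, h1 _ _, h2 _ _, G.g_zerol]

lemma IsProjector.Qv_co_left (hv : G.IsProjector v) (x y : M.X) :
    G.Qv (G.co v) (v x) y = 0 := by
  rw [Qv, co_co, hv.co_apply, G.conn_zerol, hv.map_zero]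

lemma IsProjector.Qv_co_right (hv : G.IsProjector v) (x y : M.X) :
    G.Qv (G.co v) x (v y) = 0 := by
  rw [Qv, co_co, hv.co_apply, G.conn_zeror, hv.map_zero]

lemma IsProjector.g_Qv (hv : G.IsProjector v) (x y z : M.X) :
    G.g (G.Qv v x y) (v z) = 0 := by
  rw [Qv, hv.co.2.2.2, hv.co_apply, G.g_zeror]

lemma IsProjector.killingOp_range (hv : G.IsProjector v) (x y z : M.X) :
    G.killingOp (fun a b => G.g (v a) b) (v x) (v y) (v z) = 0 := by
  simp [hv.killingOp_eq, hv.Qv_co_left, hv.g_Qv, G.g_addl, G.g_zerol]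

lemma IsProjector.geodesic_of_killingOp (hv : G.IsProjector v)
    (h : ∀ x y z, G.killingOp (fun a b => G.g (v a) b) x y z = 0) : G.Geodesic v := by
  have hQ : ∀ x y, G.Qv v (v x) (v y) = G.Qv v x y := fun x y => by
    simp only [Qv, hv.2.2.1]
  have hl : ∀ x y, G.Qv v (G.co v x) y = 0 := fun x y => by
    rw [Qv, hv.apply_co, G.conn_zerol, hv.co.map_zero]
  have hr : ∀ x y, G.Qv v y (G.co v x) = 0 := fun x y => by
    rw [Qv, hv.apply_co, G.conn_zeror, hv.co.map_zero]
  intro x y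
  apply G.eq_zero_of_g_eq_zero
  intro z
  have h1 := h (v x) (v y) (G.co v z)
  rw [hv.killingOp_eq] at h1
  simp only [hv.Qv_co_left, hv.Qv_co_right, hl, hr, hQ, add_zero, G.g_zerol, sub_zero] at h1
  have hc : ∀ a b, G.g (G.Qv v a b) (G.co v z) = G.g (G.Qv v a b) z := fun a b => by
    rw [Metric.co, G.g_subr, hv.g_Qv, sub_zero]
  rw [G.g_addl, hc, hc, ← G.g_addl] at h1
  exact h1

lemma nabla2_g (x y z : M.X) : G.nabla2 G.g x y z = 0 := by
  rw [nabla2, G.metric_compat]; ring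

/-- a constant combination of `v` and `h` differs from a constant multiple of `v` by a
parallel tensor -/
lemma nabla2_combination (v : M.X → M.X) (a b : ℝ) (x y z : M.X) :
    G.nabla2 (fun x y => algebraMap ℝ M.F a * G.g (v x) y
        + algebraMap ℝ M.F b * G.g (x - v x) y) x y z
      = algebraMap ℝ M.F (a - b) * G.nabla2 (fun x y => G.g (v x) y) x y z := by
  have h := G.nabla2_g x y z
  simp only [nabla2, M.act_addf, act_const_mul, G.g_subl, act_sub, _root_.map_sub] at h ⊢
  linear_combination algebraMap ℝ M.F b * h

lemma killingOp_combination (v : M.X → M.X) (a b : ℝ) (x y z : M.X) :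
    G.killingOp (fun x y => algebraMap ℝ M.F a * G.g (v x) y
        + algebraMap ℝ M.F b * G.g (x - v x) y) x y z
      = algebraMap ℝ M.F (a - b) * G.killingOp (fun x y => G.g (v x) y) x y z := by
  simp only [killingOp, nabla2_combination]
  ring

lemma killingOp_co (v : M.X → M.X) (x y z : M.X) :
    G.killingOp (fun x y => G.g (G.co v x) y) x y z
      = - G.killingOp (fun x y => G.g (v x) y) x y z := by
  simpa [Metric.co] using G.killingOp_combination v 0 1 x y z

lemma IsProjector.totallyGeodesic_iff (hv : G.IsProjector v) :
    (G.Geodesic v ∧ G.Geodesic (G.co v)) ↔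
      ∀ x y z, G.killingOp (fun a b => G.g (v a) b) x y z = 0 :=
  ⟨fun h => hv.killingOp_eq_zero h.1 h.2, fun h => ⟨hv.geodesic_of_killingOp h,
    hv.co.geodesic_of_killingOp fun x y z => by rw [killingOp_co, h, neg_zero]⟩⟩

lemma IsProjector.bilin_combination (hv : G.IsProjector v) (a b : M.F) :
    G.Bilin (fun x y => a * G.g (v x) y + b * G.g (x - v x) y) := by
  refine ⟨fun f x y => ?_, fun x y z => ?_, fun f x y => ?_, fun x y z => ?_⟩ <;>
    simp only [hv.1, hv.2.1, G.g_subl, G.g_smull, G.g_addl, G.g_smulr, G.g_addr] <;> ring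

lemma IsProjector.symm2_combination (hv : G.IsProjector v) (a b : M.F) :
    G.Symm2 (fun x y => a * G.g (v x) y + b * G.g (x - v x) y) := by
  intro x y
  simp only [G.g_subl]
  rw [hv.2.2.2, G.g_symm x, G.g_symm x]

/-- the trace terms of `Q_v` in the divergence of `v` vanish for a geodesic distribution -/
lemma IsProjector.trace_Qv (hv : G.IsProjector v) (h : G.Geodesic v) (z : M.X) :
    ∑ i, G.eps i * (G.g (G.Qv v (G.e i) (G.e i)) z + G.g (G.Qv v (G.e i) z) (G.e i)) = 0 := by
  have h0 : ∀ x, G.g (G.Qv v x x) z = 0 := fun x => by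
    have h2 := congrArg (fun w => G.g w z) (h x x)
    simp only [G.g_addl, G.g_zerol] at h2
    have hu : IsUnit (algebraMap ℝ M.F 2) := isUnit_algebraMap two_ne_zero
    rw [map_ofNat] at hu
    exact hu.mul_left_cancel (by linear_combination h2)
  let B : M.X →ₗ[M.F] M.X →ₗ[M.F] M.F :=
    LinearMap.mk₂ M.F (fun x y => G.g (G.conn x (v z)) y)
      (fun x y w => by rw [G.conn_addl, G.g_addl])
      (fun f x w => by rw [G.conn_smull, G.g_smull, smul_eq_mul])
      (fun x y w => G.g_addr _ _ _) (fun f x y => G.g_smulr _ _ _)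
  refine Eq.trans (Finset.sum_congr rfl fun i _ => ?_) (hv.trace_co_eq_zero B)
  rw [h0, zero_add, Qv, hv.co.2.2.2]
  rfl

lemma IsProjector.div2_eq_zero (hv : G.IsProjector v) (h1 : G.Geodesic v)
    (h2 : G.Geodesic (G.co v)) (z : M.X) : G.div2 (fun a b => G.g (v a) b) z = 0 := by
  have h := congrArg₂ (· - ·) (hv.trace_Qv h1 z) (hv.co.trace_Qv h2 z)
  simp only [sub_zero, ← Finset.sum_sub_distrib] at h
  rw [← h, div2]
  refine Finset.sum_congr rfl fun i _ => ?_
  rw [hv.nabla2_eq_Qv]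
  ring

lemma IsProjector.form_eq_zero (hv : G.IsProjector v) (p : ℕ) (hd : G.ptrace v = (p : M.F))
    (t : M.X →ₗ[M.F] M.F) (h : ∀ x y z, G.symG t (v x) (v y) (v z) = 0) (z : M.X) :
    t (v z) = 0 := by
  have hs : ∑ i, G.eps i * G.symG t (v (G.e i)) (v (G.e i)) (v z) = 0 := by simp [h]
  let vl : M.X →ₗ[M.F] M.X := { toFun := v, map_add' := hv.2.1, map_smul' := hv.1 }
  have h1 : ∑ i, G.eps i * (G.g (v z) (G.e i) * t (v (G.e i))) = t (v z) := by
    have h1 := G.sum_frame (t ∘ₗ vl) (v z)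
    change _ = t (v (v z)) at h1
    rw [hv.2.2.1] at h1
    exact h1
  have h2 : ∑ i, G.eps i * G.symG t (v (G.e i)) (v (G.e i)) (v z)
      = G.ptrace v * t (v z)
        + 2 * ∑ i, G.eps i * (G.g (v z) (G.e i) * t (v (G.e i))) := by
    rw [ptrace, Finset.sum_mul, Finset.mul_sum, ← Finset.sum_add_distrib]
    refine Finset.sum_congr rfl fun i _ => ?_
    have a1 : G.g (v (G.e i)) (v (G.e i)) = G.g (v (G.e i)) (G.e i) := by
      rw [← hv.2.2.2, hv.2.2.1]
    have a2 : G.g (v z) (v (G.e i)) = G.g (v z) (G.e i) := by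
      rw [← hv.2.2.2, hv.2.2.1]
    rw [symG, a1, G.g_symm (v (G.e i)) (v z), a2]
    ring
  rw [hs, h1, hd] at h2
  have hu : IsUnit (algebraMap ℝ M.F ((p : ℝ) + 2)) := isUnit_algebraMap (by positivity)
  rw [map_add, map_natCast, map_ofNat] at hu
  exact hu.mul_left_cancel (by linear_combination -h2)

lemma IsProjector.killingOp_eq_zero_of_conformal (hv : G.IsProjector v) {p q : ℕ}
    (hpq : p + q = n) (hd : G.ptrace v = (p : M.F)) (t : M.X →ₗ[M.F] M.F) (c : ℝ)
    (h : ∀ x y z, algebraMap ℝ M.F c * G.killingOp (fun a b => G.g (v a) b) x y z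
      = G.symG t x y z) (x y z : M.X) :
    algebraMap ℝ M.F c * G.killingOp (fun a b => G.g (v a) b) x y z = 0 := by
  have hq : G.ptrace (G.co v) = (q : M.F) := by
    rw [ptrace_co, hd, ← hpq]; push_cast; ring
  have h1 := hv.form_eq_zero p hd t fun x y z => by rw [← h, hv.killingOp_range, mul_zero]
  have h2 := hv.co.form_eq_zero q hq t fun x y z => by
    rw [← h, ← neg_neg (G.killingOp _ _ _ _), ← killingOp_co, hv.co.killingOp_range,
      neg_zero, mul_zero]
  have h3 : ∀ x, t x = 0 := fun x => by
    have hx : x = v x + G.co v x := by simp [Metric.co]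
    rw [hx, map_add, h1, h2, add_zero]
  simp [h, symG, h3]

end Projector

end Metric

/-- Corollary 1: for a `p+q` almost-product structure the following
are equivalent: it is totally geodesic; `C v + D h` is a Killing tensor for all
constants `C`, `D`; `C (q v - p h)` is a conformal tensor for all constants `C`. -/
theorem stmt_11 {M : Man} {n : ℕ} (G : Metric M n) (p q : ℕ) (hpq : p + q = n)
    (v : M.X → M.X) (hv : G.IsProjector v) (hd : G.ptrace v = (p : M.F)) :
    ((G.Geodesic v ∧ G.Geodesic (G.co v)) ↔
      ∀ C D : ℝ, G.IsKilling fun x y =>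
        algebraMap ℝ M.F C * G.g (v x) y + algebraMap ℝ M.F D * G.g (x - v x) y) ∧
    ((G.Geodesic v ∧ G.Geodesic (G.co v)) ↔
      ∀ C : ℝ, G.IsConformal fun x y =>
        algebraMap ℝ M.F C
          * ((q : M.F) * G.g (v x) y - (p : M.F) * G.g (x - v x) y)) := by
  have hT : ∀ C : ℝ, (fun x y => algebraMap ℝ M.F C
      * ((q : M.F) * G.g (v x) y - (p : M.F) * G.g (x - v x) y))
      = fun x y => algebraMap ℝ M.F (C * q) * G.g (v x) y
        + algebraMap ℝ M.F (-(C * p)) * G.g (x - v x) y := fun C => by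
    funext x y
    simp only [map_neg, map_mul, map_natCast]
    ring
  refine ⟨?_, ?_⟩
  · rw [hv.totallyGeodesic_iff]
    refine ⟨fun h C D => ⟨hv.bilin_combination _ _, hv.symm2_combination _ _, fun x y z => ?_⟩,
      fun h x y z => ?_⟩
    · rw [Metric.killingOp_combination, h, mul_zero]
    · have h1 := (h 1 0).2.2 x y z
      rw [Metric.killingOp_combination] at h1
      simpa using h1
  · simp only [hT]
    refine ⟨fun h C => ⟨hv.bilin_combination _ _, hv.symm2_combination _ _, fun x y z => ?_⟩,
      fun h => hv.totallyGeodesic_iff.mpr fun x y z => ?_⟩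
    · have hdiv := hv.div2_eq_zero h.1 h.2
      have hct : ∀ w, G.ct (fun x y => algebraMap ℝ M.F (C * q) * G.g (v x) y
          + algebraMap ℝ M.F (-(C * p)) * G.g (x - v x) y) w = 0 := fun w => by
        have hw := hdiv w
        rw [Metric.div2] at hw
        simp only [Metric.ct, Metric.div2, Metric.nabla2_combination,
          mul_left_comm (G.eps _), ← Finset.mul_sum, hw, mul_zero]
      simp only [Metric.killingOp_combination, hv.killingOp_eq_zero h.1 h.2, Metric.symG, hct,
        mul_zero, add_zero]
    · rcases Nat.eq_zero_or_pos n with hn | hn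
      · subst hn
        have h0 : ∀ w : M.X, w = 0 := fun w => by
          rw [G.frame_complete w]; simp
        rw [hv.killingOp_eq, h0 x, h0 y, h0 z]
        simp [G.g_zeror]
      · have hc := (h 1).2.2
        simp only [Metric.killingOp_combination] at hc
        have hcn : ((1 : ℝ) * q - -(1 * p)) = n := by rw [← hpq]; push_cast; ring
        let t : M.X →ₗ[M.F] M.F :=
          algebraMap ℝ M.F (2 / ((n : ℝ) + 2)) • ∑ i, G.eps i • algebraMap ℝ M.F n •
            G.gLin (G.conn (G.e i) (v (G.e i)) - v (G.conn (G.e i) (G.e i)))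
        have ht : G.ct (fun x y => algebraMap ℝ M.F (1 * q) * G.g (v x) y
            + algebraMap ℝ M.F (-(1 * p)) * G.g (x - v x) y) = t := by
          funext w
          simp only [Metric.ct, Metric.div2, Metric.nabla2_combination, hcn,
            Metric.nabla2_projector, t, LinearMap.smul_apply, LinearMap.sum_apply,
            smul_eq_mul, Metric.gLin_apply]
        rw [ht, hcn] at hc
        have h1 := hv.killingOp_eq_zero_of_conformal hpq hd t n hc x y z
        have hu : IsUnit (algebraMap ℝ M.F (n : ℝ)) :=
          Metric.isUnit_algebraMap (by positivity)
        exact hu.mul_left_cancel (by rw [h1, mul_zero])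

end KCT
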